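/- Let 0 < j < 3^n − 1 with ternary digits j_i. Suppose j ∈ S_1, {j_0, j_{(n−k) mod n}} = {1, 2}, {j_1, j_{(1−k) mod n}} = {0, 1}, and (j_1, j_0) = (0, 1). Then j_{ik mod n} = 1 for all 0 ≤ i ≤ w−1; j_{ik mod n} = 0 for i ∈ {w, n−2}; j_{ik mod n} ∈ {0, 2} for all w+1 ≤ i ≤ n−3; j_{(n−1)k mod n} = 2; and no two consecutive terms of the sequence (j_{ik mod n})_{i=w+1}^{n−3} both equal 2. -/

import Mathlib

/-- The `i`-th ternary digit (indices read modulo `n`) of the residue of `j` modulo `3^n - 1`. -/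
def dig (n : ℕ) (j : ℤ) (i : ℕ) : ℕ :=
  ((j % ((3 : ℤ) ^ n - 1)).toNat / 3 ^ (i % n)) % 3

/-- The ternary weight of (the residue modulo `3^n - 1` of) `j`. -/
def wt (n : ℕ) (j : ℤ) : ℕ := ∑ i ∈ Finset.range n, dig n j i

/-- `d = (3^k + 1)/2`. -/
def cmD (k : ℕ) : ℤ := ((3 : ℤ) ^ k + 1) / 2

/-- The set `S_1`. -/
def S1 (n k : ℕ) : Set ℤ :=
  {j | 0 < j ∧ j < 3 ^ n - 1 ∧
    wt n j + wt n (3 ^ k * j) = wt n ((3 ^ k + 1) * j) + 2 ∧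
    2 * wt n (-(j * cmD k)) = wt n (-((3 ^ k + 1) * j))}

/-- The residue of `y` modulo `3^n - 1`, its ternary digits rotated `i` places to the right. -/
def rot (n : ℕ) (y : ℤ) (i : ℕ) : ℤ := (y * 3 ^ ((n - 1) * i)) % (3 ^ n - 1)

lemma modulus_pos {n : ℕ} (hn : 0 < n) : (0 : ℤ) < 3 ^ n - 1 := by
  have : (1 : ℤ) < 3 ^ n := one_lt_pow₀ (by norm_num) hn.ne'
  linarith

lemma rot_nonneg {n : ℕ} (hn : 0 < n) (y : ℤ) (i : ℕ) : 0 ≤ rot n y i :=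
  Int.emod_nonneg _ (modulus_pos hn).ne'

lemma rot_lt {n : ℕ} (hn : 0 < n) (y : ℤ) (i : ℕ) : rot n y i < 3 ^ n - 1 :=
  Int.emod_lt_of_pos _ (modulus_pos hn)

lemma three_pow_mul_modEq_one (n m : ℕ) : (3 : ℤ) ^ (n * m) ≡ 1 [ZMOD 3 ^ n - 1] := by
  have h : (3 : ℤ) ^ n ≡ 1 [ZMOD 3 ^ n - 1] := (Int.modEq_sub _ _)
  simpa [pow_mul] using h.pow m

lemma rot_modEq (n : ℕ) (y : ℤ) (i : ℕ) :
    rot n y i ≡ y * 3 ^ ((n - 1) * i) [ZMOD 3 ^ n - 1] :=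
  Int.mod_modEq _ _

lemma three_pow_mul_rot_modEq {n : ℕ} (hn : 0 < n) (y : ℤ) (i : ℕ) :
    3 ^ i * rot n y i ≡ y [ZMOD 3 ^ n - 1] := by
  have h := (rot_modEq n y i).mul_left (3 ^ i)
  have heq : (3 : ℤ) ^ i * (y * 3 ^ ((n - 1) * i)) = y * 3 ^ (n * i) := by
    obtain ⟨m, rfl⟩ := Nat.exists_eq_add_of_lt hn
    simp only [zero_add, Nat.add_sub_cancel]
    ring
  rw [heq] at h
  simpa using h.trans ((three_pow_mul_modEq_one n i).mul_left y)

lemma isCoprime_three_pow_modulus {n : ℕ} (hn : 0 < n) (i : ℕ) :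
    IsCoprime ((3 : ℤ) ^ i) (3 ^ n - 1) := by
  apply IsCoprime.pow_left
  obtain ⟨m, rfl⟩ := Nat.exists_eq_add_of_lt hn
  exact ⟨3 ^ m, -1, by ring⟩

lemma eq_rot {n : ℕ} (hn : 0 < n) {y z : ℤ} {i : ℕ} (hz0 : 0 ≤ z) (hz : z < 3 ^ n - 1)
    (h : 3 ^ i * z ≡ y [ZMOD 3 ^ n - 1]) : z = rot n y i := by
  have h' : 3 ^ i * z ≡ 3 ^ i * rot n y i [ZMOD 3 ^ n - 1] :=
    h.trans (three_pow_mul_rot_modEq hn y i).symm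
  have hd : (3 : ℤ) ^ n - 1 ∣ rot n y i - z := by
    apply (isCoprime_three_pow_modulus hn i).symm.dvd_of_dvd_mul_left
    rw [mul_sub]
    exact h'.dvd
  have hm : z % (3 ^ n - 1) = rot n y i % (3 ^ n - 1) := (Int.modEq_iff_dvd.mpr hd)
  rwa [Int.emod_eq_of_lt hz0 hz,
    Int.emod_eq_of_lt (rot_nonneg hn y i) (rot_lt hn y i)] at hm

lemma rot_add_period {n : ℕ} (hn : 0 < n) (y : ℤ) (i m : ℕ) :
    rot n y (i + n * m) = rot n y i := by
  symm
  apply eq_rot hn (rot_nonneg hn y i) (rot_lt hn y i)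
  have h := (three_pow_mul_modEq_one n m).mul_right (3 ^ i * rot n y i)
  rw [← mul_assoc, ← pow_add, add_comm, one_mul] at h
  exact h.trans (three_pow_mul_rot_modEq hn y i)

lemma rot_mod {n : ℕ} (hn : 0 < n) (y : ℤ) (i : ℕ) : rot n y (i % n) = rot n y i := by
  conv_rhs => rw [← Nat.mod_add_div i n]
  rw [rot_add_period hn]

lemma rot_emod_three {n : ℕ} (hn : 0 < n) (y : ℤ) (i : ℕ) :
    rot n y i % 3 = dig n y i := by
  rw [← rot_mod hn]
  have hi : i % n < n := Nat.mod_lt _ hn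
  have hM := modulus_pos hn
  set e := i % n with he
  set r := y % ((3 : ℤ) ^ n - 1) with hr
  have hr0 : 0 ≤ r := Int.emod_nonneg _ hM.ne'
  have hrM : r < 3 ^ n - 1 := Int.emod_lt_of_pos _ hM
  have hp : (0 : ℤ) < 3 ^ e := by positivity
  have hq : (0 : ℤ) < 3 ^ (n - e) := by positivity
  have hpq : (3 : ℤ) ^ e * 3 ^ (n - e) = 3 ^ n := by
    rw [← pow_add]
    congr 1
    omega
  have hsplit : 3 ^ e * (r / 3 ^ e) + r % 3 ^ e = r := Int.mul_ediv_add_emod r (3 ^ e)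
  have hl0 : 0 ≤ r % 3 ^ e := Int.emod_nonneg _ hp.ne'
  have hl : r % 3 ^ e < 3 ^ e := Int.emod_lt_of_pos _ hp
  have hh0 : 0 ≤ r / 3 ^ e := Int.ediv_nonneg hr0 hp.le
  have hh : r / 3 ^ e < 3 ^ (n - e) := by
    apply Int.ediv_lt_of_lt_mul hp
    rw [mul_comm, hpq]
    linarith
  have hdig : (dig n y i : ℤ) = r / 3 ^ e % 3 := by
    unfold dig
    push_cast
    rw [Int.toNat_of_nonneg hr0]
  set l := r % 3 ^ e
  set h := r / 3 ^ e
  have hrot : l * 3 ^ (n - e) + h = rot n y e := by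
    apply eq_rot hn (by positivity)
    · by_contra! hcon
      have hl' : l = 3 ^ e - 1 := by
        by_contra hne
        have : l ≤ 3 ^ e - 2 := by omega
        nlinarith
      have hh' : h = 3 ^ (n - e) - 1 := by
        rw [hl'] at hcon
        nlinarith
      rw [hl', hh'] at hsplit
      nlinarith
    · have hy : r ≡ y [ZMOD 3 ^ n - 1] := Int.mod_modEq _ _
      refine Int.ModEq.trans (Int.modEq_iff_dvd.mpr ⟨-l, ?_⟩) hy
      linear_combination hpq * (-l) - hsplit
  rw [← hrot, hdig]
  obtain ⟨m, hm⟩ : ∃ m, n - e = m + 1 := ⟨n - e - 1, by omega⟩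
  rw [hm, pow_succ, ← mul_assoc]
  omega

lemma modulus_mul_dig {n : ℕ} (hn : 0 < n) (y : ℤ) (i : ℕ) :
    (3 ^ n - 1) * (dig n y i : ℤ) = 3 * rot n y (i + 1) - rot n y i := by
  have hM := modulus_pos hn
  obtain ⟨q, hq⟩ : (3 : ℤ) ^ n - 1 ∣ 3 * rot n y (i + 1) - rot n y i := by
    have h := (three_pow_mul_rot_modEq hn y i).trans (three_pow_mul_rot_modEq hn y (i + 1)).symm
    have hd := h.dvd
    rw [pow_succ, mul_assoc, ← mul_sub] at hd
    exact (isCoprime_three_pow_modulus hn i).symm.dvd_of_dvd_mul_left hd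
  have h0 := rot_nonneg hn y i
  have h1 := rot_nonneg hn y (i + 1)
  have h2 := rot_lt hn y i
  have h3 := rot_lt hn y (i + 1)
  have hq0 : 0 ≤ q := by
    by_contra! hneg
    nlinarith [mul_le_mul_of_nonneg_left (show q ≤ -1 by omega) hM.le]
  have hq2 : q < 3 := by
    by_contra! hbig
    nlinarith [mul_le_mul_of_nonneg_left hbig hM.le]
  have hd := rot_emod_three hn y i
  obtain ⟨m, rfl⟩ := Nat.exists_eq_add_of_lt hn
  have hqd : q = dig (0 + m + 1) y i := by
    rw [pow_succ, sub_mul, mul_right_comm] at hq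
    omega
  rw [hq, hqd]

lemma dig_le_two (n : ℕ) (y : ℤ) (i : ℕ) : dig n y i ≤ 2 :=
  Nat.le_of_lt_succ (Nat.mod_lt _ (by norm_num))

lemma dig_congr {n : ℕ} {y : ℤ} {i i' : ℕ} (h : i ≡ i' [MOD n]) : dig n y i = dig n y i' := by
  unfold dig
  rw [h]

lemma modulus_mul_wt {n : ℕ} (hn : 0 < n) (y : ℤ) :
    (3 ^ n - 1) * (wt n y : ℤ) = 2 * ∑ i ∈ Finset.range n, rot n y i := by
  have hper : rot n y n = rot n y 0 := by simpa using rot_add_period hn y 0 1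
  have hsucc := (Finset.sum_range_succ (rot n y) n).symm.trans (Finset.sum_range_succ' (rot n y) n)
  unfold wt
  push_cast
  rw [Finset.mul_sum, Finset.sum_congr rfl fun i _ ↦ modulus_mul_dig hn y i,
    Finset.sum_sub_distrib, ← Finset.mul_sum]
  linarith

/-- Addition with carries modulo `3^n - 1`; `c i` is the carry into position `i`. -/
lemma exists_carry {n : ℕ} (hn : 0 < n) (a b : ℤ) :
    ∃ c : ℕ → ℕ, (∀ i, c i ≤ 1) ∧ (∀ i, c (i % n) = c i) ∧
      (∀ i, dig n a i + dig n b i + c i = dig n (a + b) i + 3 * c (i + 1)) ∧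
      wt n a + wt n b = wt n (a + b) + 2 * ∑ i ∈ Finset.range n, c i := by
  have hM := modulus_pos hn
  have key : ∀ i, ∃ c : ℕ, c ≤ 1 ∧ rot n a i + rot n b i = rot n (a + b) i + (3 ^ n - 1) * c := by
    intro i
    have ha := rot_nonneg hn a i
    have hb := rot_nonneg hn b i
    have ha' := rot_lt hn a i
    have hb' := rot_lt hn b i
    have hab : rot n (a + b) i = (rot n a i + rot n b i) % (3 ^ n - 1) := by
      simp only [rot, add_mul, Int.emod_add_emod, Int.add_emod_emod]
    rcases lt_or_ge (rot n a i + rot n b i) (3 ^ n - 1) with h | h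
    · refine ⟨0, by norm_num, ?_⟩
      rw [hab, Int.emod_eq_of_lt (by linarith) h]
      simp
    · refine ⟨1, le_rfl, ?_⟩
      rw [hab, ← Int.sub_emod_right, Int.emod_eq_of_lt (by linarith) (by linarith)]
      push_cast
      ring
  choose c hc1 hc using key
  refine ⟨c, hc1, fun i ↦ ?_, fun i ↦ ?_, ?_⟩
  · have h1 := hc (i % n)
    rw [rot_mod hn, rot_mod hn, rot_mod hn, hc i] at h1
    have := mul_left_cancel₀ hM.ne' (add_left_cancel h1)
    exact_mod_cast this.symm
  · have h : (3 ^ n - 1) * ((dig n a i + dig n b i + c i : ℕ) : ℤ) =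
        (3 ^ n - 1) * ((dig n (a + b) i + 3 * c (i + 1) : ℕ) : ℤ) := by
      push_cast
      linear_combination modulus_mul_dig hn a i + modulus_mul_dig hn b i
        - modulus_mul_dig hn (a + b) i + 3 * hc (i + 1) - hc i
    exact_mod_cast mul_left_cancel₀ hM.ne' h
  · have hsum := Finset.sum_congr (rfl : Finset.range n = Finset.range n) fun i _ ↦ hc i
    rw [Finset.sum_add_distrib, Finset.sum_add_distrib, ← Finset.mul_sum] at hsum
    have h : (3 ^ n - 1) * ((wt n a + wt n b : ℕ) : ℤ) =
        (3 ^ n - 1) * ((wt n (a + b) + 2 * ∑ i ∈ Finset.range n, c i : ℕ) : ℤ) := by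
      push_cast
      linear_combination modulus_mul_wt hn a + modulus_mul_wt hn b
        - modulus_mul_wt hn (a + b) + 2 * hsum
    exact_mod_cast mul_left_cancel₀ hM.ne' h

lemma dig_three_pow_mul {n : ℕ} (hn : 0 < n) (k : ℕ) (y : ℤ) (i : ℕ) :
    dig n (3 ^ k * y) (i + k) = dig n y i := by
  have h : rot n y i = rot n (3 ^ k * y) (i + k) := by
    apply eq_rot hn (rot_nonneg hn y i) (rot_lt hn y i)
    convert (three_pow_mul_rot_modEq hn y i).mul_left (3 ^ k) using 1
    ring
  have h' := rot_emod_three hn (3 ^ k * y) (i + k)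
  rw [← h, rot_emod_three hn] at h'
  exact_mod_cast h'.symm

lemma dig_neg {n : ℕ} (hn : 0 < n) (y : ℤ) :
    (∀ i, dig n (-y) i = 0) ∨ ∀ i, dig n (-y) i + dig n y i = 2 := by
  by_cases hy : (3 : ℤ) ^ n - 1 ∣ y
  · left
    intro i
    unfold dig
    rw [Int.emod_eq_zero_of_dvd ((dvd_neg).mpr hy)]
    simp
  · right
    have hrot : ∀ i, rot n (-y) i = 3 ^ n - 1 - rot n y i := by
      intro i
      symm
      have hne : rot n y i ≠ 0 := by
        intro h0
        have h := three_pow_mul_rot_modEq hn y i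
        rw [h0, mul_zero] at h
        exact hy (by simpa using h.dvd)
      have h0 := rot_nonneg hn y i
      apply eq_rot hn (by linarith [rot_lt hn y i]) (by omega)
      have h := (three_pow_mul_rot_modEq hn y i).neg
      refine Int.ModEq.trans (Int.modEq_iff_dvd.mpr ⟨-3 ^ i, ?_⟩) h
      ring
    intro i
    have h : (3 ^ n - 1) * ((dig n (-y) i + dig n y i : ℕ) : ℤ) = (3 ^ n - 1) * ((2 : ℕ) : ℤ) := by
      push_cast
      linear_combination modulus_mul_dig hn (-y) i + modulus_mul_dig hn y i
        + 3 * hrot (i + 1) - hrot i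
    exact_mod_cast mul_left_cancel₀ (modulus_pos hn).ne' h

lemma even_dig_of_two_mul_wt_neg {n : ℕ} (hn : 0 < n) {u : ℤ}
    (h : 2 * wt n (-u) = wt n (-(2 * u))) (i : ℕ) : Even (dig n (2 * u) i) := by
  obtain ⟨c, -, hper, hdig, hwt⟩ := exists_carry hn (-u) (-u)
  rw [show -u + -u = -(2 * u) by ring] at hdig hwt
  have hsum : ∑ i ∈ Finset.range n, c i = 0 := by omega
  have hc : ∀ m, c m = 0 := fun m ↦ by
    rw [← hper]
    exact Finset.sum_eq_zero_iff.mp hsum _ (Finset.mem_range.mpr (Nat.mod_lt _ hn))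
  have hi := hdig i
  rw [hc, hc] at hi
  have h2 := dig_neg hn (-(2 * u))
  rw [neg_neg] at h2
  rcases h2 with h2 | h2 <;> have h2 := h2 i <;> rw [Nat.even_iff] <;> omega

/-- If the weight drops by two, there is a single carry, and it is located by the digits at `0`. -/
lemma dig_add_of_single_carry {n : ℕ} (hn : 2 ≤ n) {a b : ℤ}
    (h : wt n a + wt n b = wt n (a + b) + 2) (h0 : dig n a 0 + dig n b 0 = 3) {i : ℕ}
    (hi0 : ¬ i ≡ 0 [MOD n]) (hi1 : ¬ i ≡ 1 [MOD n]) :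
    dig n (a + b) i = dig n a i + dig n b i := by
  have hn0 : 0 < n := by omega
  obtain ⟨c, hc1, hper, hdig, hwt⟩ := exists_carry hn0 a b
  have hsum : ∑ i ∈ Finset.range n, c i = 1 := by omega
  have hone : c 1 = 1 := by
    have := hdig 0
    rw [zero_add] at this
    have := dig_le_two n (a + b) 0
    have := hc1 1
    omega
  have hzero : ∀ m, ¬ m ≡ 1 [MOD n] → c m = 0 := by
    intro m hm
    rw [← hper]
    have hmem : 1 ∈ Finset.range n := Finset.mem_range.mpr (by omega)
    have herase := Finset.add_sum_erase _ c hmem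
    have hs : ∑ i ∈ (Finset.range n).erase 1, c i = 0 := by omega
    refine Finset.sum_eq_zero_iff.mp hs _ (Finset.mem_erase.mpr
      ⟨fun h1 ↦ hm ?_, Finset.mem_range.mpr (Nat.mod_lt _ hn0)⟩)
    rw [Nat.ModEq, h1, Nat.mod_eq_of_lt (by omega)]
  have := hdig i
  rw [hzero i hi1, hzero (i + 1) fun h' ↦ hi0 (Nat.ModEq.add_right_cancel' 1 h')] at this
  omega

theorem stmt9 (n k : ℕ) (hn : 2 ≤ n) (hkodd : Odd k) (hk0 : 0 < k) (hkn : k < n)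
    (hgcd : Nat.gcd n k = 1) (w : ℕ) (hw0 : 0 < w) (hwn : w < n) (hwk : w * k ≡ 1 [MOD n])
    (j : ℤ) (hj : j ∈ S1 n k)
    (h0 : (dig n j 0 = 1 ∧ dig n j (n - k) = 2) ∨ (dig n j 0 = 2 ∧ dig n j (n - k) = 1))
    (h1 : (dig n j 1 = 0 ∧ dig n j (n - k + 1) = 1) ∨
      (dig n j 1 = 1 ∧ dig n j (n - k + 1) = 0))
    (hj1 : dig n j 1 = 0) (hj0 : dig n j 0 = 1) :
    (∀ i, i ≤ w - 1 → dig n j (i * k) = 1) ∧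
    dig n j (w * k) = 0 ∧ dig n j ((n - 2) * k) = 0 ∧
    (∀ i, w + 1 ≤ i → i ≤ n - 3 → dig n j (i * k) = 0 ∨ dig n j (i * k) = 2) ∧
    dig n j ((n - 1) * k) = 2 ∧
    (∀ i, w + 1 ≤ i → i + 1 ≤ n - 3 →
      ¬(dig n j (i * k) = 2 ∧ dig n j ((i + 1) * k) = 2)) := by
  have hn0 : 0 < n := by omega
  obtain ⟨-, -, hwt1, hwt2⟩ := hj
  have htwo : 2 * (j * cmD k) = (3 ^ k + 1) * j := by
    have hev : 2 * cmD k = 3 ^ k + 1 :=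
      Int.mul_ediv_cancel' (Odd.pow (by decide : Odd (3 : ℤ))).add_one.two_dvd
    rw [← hev]
    ring
  have heven : ∀ i, Even (dig n ((3 ^ k + 1) * j) i) := fun i ↦ by
    rw [← htwo] at hwt2 ⊢
    exact even_dig_of_two_mul_wt_neg hn0 hwt2 i
  have hsum : (3 ^ k + 1) * j = j + 3 ^ k * j := by ring
  rw [hsum] at hwt1 heven
  have hcarry : dig n j 0 + dig n (3 ^ k * j) 0 = 3 := by
    have h : dig n (3 ^ k * j) 0 = dig n j (n - k) := by
      rw [← dig_three_pow_mul hn0 k j (n - k)]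
      apply dig_congr
      rw [Nat.sub_add_cancel hkn.le]
      exact (Nat.modEq_zero_iff_dvd.mpr dvd_rfl).symm
    omega
  have hstep : ∀ m, m + 1 < n → m + 1 ≠ w →
      dig n j (m * k) + dig n j ((m + 1) * k) = 0 ∨
        dig n j (m * k) + dig n j ((m + 1) * k) = 2 := by
    intro m hm hmw
    have hne0 : ¬ (m + 1) * k ≡ 0 [MOD n] := fun h ↦ by
      have hd := Nat.Coprime.dvd_of_dvd_mul_right hgcd (Nat.modEq_zero_iff_dvd.mp h)
      exact absurd (Nat.le_of_dvd (by omega) hd) (by omega)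
    have hne1 : ¬ (m + 1) * k ≡ 1 [MOD n] := fun h ↦ by
      have h' := Nat.ModEq.cancel_right_of_coprime hgcd (h.trans hwk.symm)
      exact hmw (h'.eq_of_lt_of_lt hm hwn)
    have h := dig_add_of_single_carry hn hwt1 hcarry hne0 hne1
    have hshift : dig n (3 ^ k * j) ((m + 1) * k) = dig n j (m * k) := by
      rw [add_one_mul, dig_three_pow_mul hn0]
    have hle := dig_le_two n (j + 3 ^ k * j) ((m + 1) * k)
    have he := Nat.even_iff.mp (heven ((m + 1) * k))
    omega
  have hw : dig n j (w * k) = 0 := (dig_congr hwk).trans hj1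
  have hlast : dig n j ((n - 1) * k) = 2 := by
    have h : dig n j ((n - 1) * k) = dig n j (n - k) := by
      apply dig_congr
      apply Nat.ModEq.add_right_cancel' k
      rw [← add_one_mul, Nat.sub_add_cancel (by omega : 1 ≤ n), Nat.sub_add_cancel hkn.le]
      exact (Nat.modEq_zero_iff_dvd.mpr (dvd_mul_right n k)).trans
        (Nat.modEq_zero_iff_dvd.mpr dvd_rfl).symm
    omega
  have hwlast : w ≠ n - 1 := by
    rintro rfl
    omega
  have htail : ∀ i, w ≤ i → i < n → dig n j (i * k) = 0 ∨ dig n j (i * k) = 2 := by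
    intro i hi
    induction i, hi using Nat.le_induction with
    | base => exact fun _ ↦ Or.inl hw
    | succ m hm ih =>
      intro hmn
      have := ih (by omega)
      have := hstep m hmn (by omega)
      omega
  refine ⟨fun i ↦ ?_, hw, ?_, fun i hi hi' ↦ htail i (by omega) (by omega), hlast,
    fun i hi hi' ↦ ?_⟩
  · induction i with
    | zero => simpa using hj0
    | succ m ih =>
      intro hm
      have := ih (by omega)
      have := hstep m (by omega) (by omega)
      omega
  · have h := hstep (n - 2) (by omega) (by omega)
    rw [show n - 2 + 1 = n - 1 by omega] at h
    omega
  · have := hstep i (by omega) (by omega)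
    omega
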